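/- For every n ≥ 0, every x ∈ X, and every s ∈ ℤ: v^L_n(x) ≤ v_n(x,s). -/

import Mathlib

open Finset

noncomputable section

open scoped Classical

namespace InvCtrl

variable {N M : ℕ} {Z : Type*}

/-- Membership in the belief space `X ⊆ ℝ^N`. -/
def memX (N : ℕ) (x : Fin N → ℝ) : Prop :=
  (∀ i, 0 ≤ x i) ∧ ∑ i, x i = 1

variable [Fintype Z]

/-- `σ(d_k, z, x) = x ⬝ P(d_k, z) ⬝ 𝟙`. -/
def sigz (P : Fin M → Z → Matrix (Fin N) (Fin N) ℝ) (k : Fin M) (z : Z) (x : Fin N → ℝ) : ℝ :=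
  ∑ i, x i * ∑ j, P k z i j

/-- `σ(d_k, x) = ∑_z σ(d_k, z, x)`. -/
def sig (P : Fin M → Z → Matrix (Fin N) (Fin N) ℝ) (k : Fin M) (x : Fin N → ℝ) : ℝ :=
  ∑ z, sigz P k z x

/-- Posterior belief `λ(d_k, z, x) = x P(d_k, z) / σ(d_k, z, x)` (componentwise). -/
def lam (P : Fin M → Z → Matrix (Fin N) (Fin N) ℝ) (k : Fin M) (z : Z) (x : Fin N → ℝ) :
    Fin N → ℝ :=
  fun j => (∑ i, x i * P k z i j) / sigz P k z x

/-- Single-period cost `c(y, d) = p·(d − y)⁺ + h·(y − d)⁺`. -/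
def cst (p hc y dd : ℝ) : ℝ := p * max (dd - y) 0 + hc * max (y - dd) 0

/-- Expected single-period cost `L(x, y) = ∑_k σ(d_k, x) c(y, d_k)`. -/
def Lf (P : Fin M → Z → Matrix (Fin N) (Fin N) ℝ) (d : Fin M → ℤ) (p hc : ℝ)
    (x : Fin N → ℝ) (y : ℝ) : ℝ :=
  ∑ k, sig P k x * cst p hc y (d k : ℝ)

/-- `s*(x)`: the smallest element of `{d_1, …, d_M}` at which `m ↦ L(x, d_m)` is minimized. -/
def sStar (P : Fin M → Z → Matrix (Fin N) (Fin N) ℝ) (d : Fin M → ℤ) (p hc : ℝ)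
    (x : Fin N → ℝ) : ℤ :=
  sInf {t : ℤ | ∃ m : Fin M, t = d m ∧ ∀ k : Fin M, Lf P d p hc x (d m : ℝ) ≤ Lf P d p hc x (d k : ℝ)}

/-- First-order stochastic dominance `x ⪯ x'`. -/
def sdom (x x' : Fin N → ℝ) : Prop :=
  ∀ n : Fin N, ∑ i ∈ univ.filter (fun i => n ≤ i), x i ≤ ∑ i ∈ univ.filter (fun i => n ≤ i), x' i

/-- The `i`-th standard unit vector in `ℝ^N`. -/
def eV (N : ℕ) (i : Fin N) : Fin N → ℝ := fun j => if j = i then 1 else 0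

/-- Assumption A3. -/
def A3 (P : Fin M → Z → Matrix (Fin N) (Fin N) ℝ) : Prop :=
  ∀ i i' : Fin N, i ≤ i' → ∀ m : Fin M,
    ∑ k ∈ univ.filter (fun k : Fin M => m ≤ k), ∑ j, ∑ z, P k z i j ≤
      ∑ k ∈ univ.filter (fun k : Fin M => m ≤ k), ∑ j, ∑ z, P k z i' j

/-- `A_m(x) = h ∑_{k=1}^m σ(d_k,x) − p ∑_{k=m+1}^M σ(d_k,x)` (for `m = 0, …, M`). -/
def Am (P : Fin M → Z → Matrix (Fin N) (Fin N) ℝ) (p hc : ℝ) (m : ℕ) (x : Fin N → ℝ) : ℝ :=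
  hc * ∑ k ∈ univ.filter (fun k : Fin M => (k : ℕ) < m), sig P k x
    - p * ∑ k ∈ univ.filter (fun k : Fin M => m ≤ (k : ℕ)), sig P k x

/-- `B_m(x) = p ∑_{k=m+1}^M d_k σ(d_k,x) − h ∑_{k=1}^m d_k σ(d_k,x)` (for `m = 0, …, M`). -/
def Bm (P : Fin M → Z → Matrix (Fin N) (Fin N) ℝ) (d : Fin M → ℤ) (p hc : ℝ) (m : ℕ)
    (x : Fin N → ℝ) : ℝ :=
  p * ∑ k ∈ univ.filter (fun k : Fin M => m ≤ (k : ℕ)), (d k : ℝ) * sig P k x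
    - hc * ∑ k ∈ univ.filter (fun k : Fin M => (k : ℕ) < m), (d k : ℝ) * sig P k x

/-- Finite-horizon value iteration: `v_0 = 0` and
`v_{n+1}(x,s) = inf_{y ≥ s, y ∈ ℤ} [ L(x,y) + β ∑_{(d_k,z) : σ(d_k,z,x) ≠ 0} σ(d_k,z,x)
v_n(λ(d_k,z,x), f(y,d_k)) ]`, for a general transition `f` of the inventory position. -/
def vIter (P : Fin M → Z → Matrix (Fin N) (Fin N) ℝ) (d : Fin M → ℤ) (p hc β : ℝ)
    (f : ℤ → ℤ → ℤ) : ℕ → (Fin N → ℝ) → ℤ → ℝ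
  | 0, _, _ => 0
  | n + 1, x, s =>
    sInf {r : ℝ | ∃ y : ℤ, s ≤ y ∧
      r = Lf P d p hc x (y : ℝ) + β * ∑ k, ∑ z,
        (if sigz P k z x = 0 then 0
         else sigz P k z x * vIter P d p hc β f n (lam P k z x) (f y (d k)))}

/-- The lower-bound iteration: `v^L_0 = 0` and
`v^L_{n+1}(x) = L(x, s*(x)) + β ∑_{(d_k,z) : σ ≠ 0} σ(d_k,z,x) v^L_n(λ(d_k,z,x))`. -/
def vLow (P : Fin M → Z → Matrix (Fin N) (Fin N) ℝ) (d : Fin M → ℤ) (p hc β : ℝ) :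
    ℕ → (Fin N → ℝ) → ℝ
  | 0, _ => 0
  | n + 1, x =>
    Lf P d p hc x ((sStar P d p hc x : ℤ) : ℝ) + β * ∑ k, ∑ z,
      (if sigz P k z x = 0 then 0
       else sigz P k z x * vLow P d p hc β n (lam P k z x))

/-- The upper-bound iteration (cost of the myopic "order up to `max{s*(x),s}`" policy):
`v^U_0 = 0` and, with `y(x,s) = max{s*(x),s}`,
`v^U_{n+1}(x,s) = L(x,y(x,s)) + β ∑_{(d_k,z) : σ ≠ 0} σ(d_k,z,x)
v^U_n(λ(d_k,z,x), y(x,s) − d_k)`. -/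
def vUp (P : Fin M → Z → Matrix (Fin N) (Fin N) ℝ) (d : Fin M → ℤ) (p hc β : ℝ) :
    ℕ → (Fin N → ℝ) → ℤ → ℝ
  | 0, _, _ => 0
  | n + 1, x, s =>
    Lf P d p hc x ((max (sStar P d p hc x) s : ℤ) : ℝ) + β * ∑ k, ∑ z,
      (if sigz P k z x = 0 then 0
       else sigz P k z x * vUp P d p hc β n (lam P k z x) (max (sStar P d p hc x) s - d k))

theorem sigz_nonneg (P : Fin M → Z → Matrix (Fin N) (Fin N) ℝ)
    (hPnn : ∀ k z i j, 0 ≤ P k z i j) (x : Fin N → ℝ) (hx : memX N x) (k : Fin M) (z : Z) :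
    0 ≤ sigz P k z x :=
  Finset.sum_nonneg fun i _ => mul_nonneg (hx.1 i) (Finset.sum_nonneg fun j _ => hPnn k z i j)

theorem lam_mem (P : Fin M → Z → Matrix (Fin N) (Fin N) ℝ)
    (hPnn : ∀ k z i j, 0 ≤ P k z i j) (x : Fin N → ℝ) (hx : memX N x) (k : Fin M) (z : Z)
    (h : sigz P k z x ≠ 0) : memX N (lam P k z x) := by
  refine ⟨fun j => div_nonneg (Finset.sum_nonneg fun i _ => mul_nonneg (hx.1 i) (hPnn k z i j))
    (sigz_nonneg P hPnn x hx k z), ?_⟩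
  unfold lam
  rw [← Finset.sum_div, Finset.sum_comm]
  have : ∑ i, ∑ j, x i * P k z i j = sigz P k z x := by
    unfold sigz
    exact Finset.sum_congr rfl fun i _ => (Finset.mul_sum _ _ _).symm
  rw [this, div_self h]

theorem cst_interp (p hc a b y t : ℝ) (hay : a ≤ y) (hyb : y ≤ b) (ht : t ≤ a ∨ b ≤ t) :
    (b - a) * cst p hc y t = (b - y) * cst p hc a t + (y - a) * cst p hc b t := by
  unfold cst
  rcases ht with ht | ht
  · rw [max_eq_right (by linarith : t - y ≤ 0), max_eq_right (by linarith : t - a ≤ 0),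
      max_eq_right (by linarith : t - b ≤ 0), max_eq_left (by linarith : 0 ≤ y - t),
      max_eq_left (by linarith : 0 ≤ a - t), max_eq_left (by linarith : 0 ≤ b - t)]
    ring
  · rw [max_eq_left (by linarith : 0 ≤ t - y), max_eq_left (by linarith : 0 ≤ t - a),
      max_eq_left (by linarith : 0 ≤ t - b), max_eq_right (by linarith : y - t ≤ 0),
      max_eq_right (by linarith : a - t ≤ 0), max_eq_right (by linarith : b - t ≤ 0)]
    ring

theorem exists_Lf_le (hM : 1 ≤ M) (P : Fin M → Z → Matrix (Fin N) (Fin N) ℝ)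
    (d : Fin M → ℤ) (p hc : ℝ) (hp : 0 < p) (hhc : 0 < hc) (x : Fin N → ℝ)
    (hs : ∀ k, 0 ≤ sig P k x) (y : ℝ) :
    ∃ m, Lf P d p hc x (d m : ℝ) ≤ Lf P d p hc x y := by
  have hne : Nonempty (Fin M) := ⟨⟨0, hM⟩⟩
  by_cases hA : (univ.filter fun k : Fin M => (d k : ℝ) ≤ y).Nonempty
  · obtain ⟨a, ha, ha'⟩ := Finset.exists_max_image _ (fun k => (d k : ℝ)) hA
    simp only [Finset.mem_filter, Finset.mem_univ, true_and] at ha ha'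
    by_cases hB : (univ.filter fun k : Fin M => y < (d k : ℝ)).Nonempty
    · obtain ⟨b, hb, hb'⟩ := Finset.exists_min_image _ (fun k => (d k : ℝ)) hB
      simp only [Finset.mem_filter, Finset.mem_univ, true_and] at hb hb'
      have key : ((d b : ℝ) - d a) * Lf P d p hc x y
          = (d b - y) * Lf P d p hc x (d a) + (y - d a) * Lf P d p hc x (d b) := by
        unfold Lf
        rw [Finset.mul_sum, Finset.mul_sum, Finset.mul_sum, ← Finset.sum_add_distrib]
        refine Finset.sum_congr rfl fun k _ => ?_
        have := cst_interp p hc (d a) (d b) y (d k) ha hb.le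
          (by
            rcases le_or_gt (d k : ℝ) y with h | h
            · exact Or.inl (ha' k h)
            · exact Or.inr (hb' k h))
        linear_combination (sig P k x) * this
      by_contra! hcon
      have h1 := hcon a
      have h2 := hcon b
      nlinarith [mul_pos (sub_pos.2 hb) (sub_pos.2 h1),
        mul_nonneg (sub_nonneg.2 ha) (sub_pos.2 h2).le]
    · refine ⟨a, Finset.sum_le_sum fun k _ => mul_le_mul_of_nonneg_left ?_ (hs k)⟩
      have hk : (d k : ℝ) ≤ y := by
        by_contra! h
        exact hB ⟨k, by simpa using h⟩
      have hka := ha' k hk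
      unfold cst
      rw [max_eq_right (by linarith : (d k : ℝ) - y ≤ 0),
        max_eq_right (by linarith : (d k : ℝ) - d a ≤ 0),
        max_eq_left (by linarith : 0 ≤ y - (d k : ℝ)),
        max_eq_left (by linarith : 0 ≤ (d a : ℝ) - d k)]
      nlinarith
  · obtain ⟨b, -, hb'⟩ := Finset.exists_min_image (univ : Finset (Fin M))
      (fun k => (d k : ℝ)) Finset.univ_nonempty
    have hy : ∀ k, y < (d k : ℝ) := fun k => by
      by_contra! h
      exact hA ⟨k, by simpa using h⟩
    refine ⟨b, Finset.sum_le_sum fun k _ => mul_le_mul_of_nonneg_left ?_ (hs k)⟩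
    have hk := hy k
    have hkb := hb' k (Finset.mem_univ k)
    have hyb := hy b
    unfold cst
    rw [max_eq_left (by linarith : 0 ≤ (d k : ℝ) - y),
      max_eq_left (by linarith : 0 ≤ (d k : ℝ) - d b),
      max_eq_right (by linarith : y - (d k : ℝ) ≤ 0),
      max_eq_right (by linarith : (d b : ℝ) - d k ≤ 0)]
    nlinarith

theorem Lf_sStar_le (hM : 1 ≤ M) (P : Fin M → Z → Matrix (Fin N) (Fin N) ℝ)
    (d : Fin M → ℤ) (p hc : ℝ) (hp : 0 < p) (hhc : 0 < hc) (x : Fin N → ℝ)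
    (hs : ∀ k, 0 ≤ sig P k x) (y : ℝ) :
    Lf P d p hc x ((sStar P d p hc x : ℤ) : ℝ) ≤ Lf P d p hc x y := by
  have hne : Nonempty (Fin M) := ⟨⟨0, hM⟩⟩
  have hmem : sStar P d p hc x ∈ {t : ℤ | ∃ m : Fin M, t = d m ∧
      ∀ k : Fin M, Lf P d p hc x (d m : ℝ) ≤ Lf P d p hc x (d k : ℝ)} := by
    apply Int.csInf_mem
    · obtain ⟨m, -, hm⟩ := Finset.exists_min_image (univ : Finset (Fin M))
        (fun k => Lf P d p hc x (d k : ℝ)) Finset.univ_nonempty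
      exact ⟨d m, m, rfl, fun k => hm k (Finset.mem_univ k)⟩
    · refine ((Set.finite_range d).subset ?_).bddBelow
      rintro t ⟨m, rfl, -⟩
      exact ⟨m, rfl⟩
  obtain ⟨m, hm, hmin⟩ := hmem
  obtain ⟨k, hk⟩ := exists_Lf_le hM P d p hc hp hhc x hs y
  rw [hm]
  exact (hmin k).trans hk

/-- Proposition 2: `v^L_n(x) ≤ v_n(x,s)` for every `n`, `x ∈ X`, `s ∈ ℤ`. -/
theorem stmt9 {N M : ℕ} {Z : Type*} [Fintype Z] [Nonempty Z]
    (hN : 1 ≤ N) (hM : 1 ≤ M)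
    (d : Fin M → ℤ) (hd : StrictMono d)
    (P : Fin M → Z → Matrix (Fin N) (Fin N) ℝ)
    (hPnn : ∀ k z i j, 0 ≤ P k z i j)
    (hPst : ∀ i : Fin N, ∑ k : Fin M, ∑ z : Z, ∑ j : Fin N, P k z i j = 1)
    (p hc : ℝ) (hp : 0 < p) (hhc : 0 < hc)
    (β : ℝ) (hβ0 : 0 ≤ β) (hβ1 : β < 1) :
    ∀ (n : ℕ) (x : Fin N → ℝ) (s : ℤ), memX N x →
      vLow P d p hc β n x ≤ vIter P d p hc β (fun y dd => y - dd) n x s := by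
  intro n
  induction n with
  | zero => intro x s _; simp [vLow, vIter]
  | succ n ih =>
    intro x s hx
    have hz := sigz_nonneg P hPnn x hx
    rw [vLow, vIter]
    apply le_csInf
    · exact ⟨_, s, le_rfl, rfl⟩
    · rintro r ⟨y, -, rfl⟩
      refine add_le_add (Lf_sStar_le hM P d p hc hp hhc x
        (fun k => Finset.sum_nonneg fun z _ => hz k z) y) ?_
      refine mul_le_mul_of_nonneg_left ?_ hβ0
      refine Finset.sum_le_sum fun k _ => Finset.sum_le_sum fun z _ => ?_
      split_ifs with h
      · exact le_rfl
      · exact mul_le_mul_of_nonneg_left (ih _ _ (lam_mem P hPnn x hx k z h)) (hz k z)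

end InvCtrl
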